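/- arXiv:math/0312152 — 2 statements merged into one kernel-verified Lean document; each statement's English description precedes it below -/
import Mathlib

section
/- Let Λ be a k-graph. For every vertex v of Λ, every E ⊆ vΛ, every λ₁ ∈ vΛ, and every λ₂ ∈ s(λ₁)Λ, we have Ext(λ₂; Ext(λ₁;E)) = Ext(λ₁λ₂; E). -/
open scoped ENNReal

attribute [local instance] Classical.propDecidable

/-- Product of `f` over a set `S`, in some arbitrary order (junk value `1` if `S` is
infinite).  Used for products of commuting projections. -/
noncomputable def listProd {ι A : Type*} [Monoid A] (S : Set ι) (f : ι → A) : A :=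
  if h : S.Finite then (h.toFinset.toList.map f).prod else 1

/-- A `k`-graph: a countable category `Λ` (whose morphisms are the terms of `Path`, with
vertices identified with the morphisms of degree `0`) together with a degree functor
`d : Λ → ℕ^k` satisfying the factorisation property. -/
structure KGraph (k : ℕ) where
  Path : Type
  countable : Countable Path
  d : Path → Fin k → ℕ
  r : Path → Path
  s : Path → Path
  comp : Path → Path → Path
  d_r : ∀ lam, d (r lam) = 0
  d_s : ∀ lam, d (s lam) = 0
  r_r : ∀ lam, r (r lam) = r lam
  s_r : ∀ lam, s (r lam) = r lam
  r_s : ∀ lam, r (s lam) = s lam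
  s_s : ∀ lam, s (s lam) = s lam
  comp_source : ∀ lam, comp lam (s lam) = lam
  range_comp : ∀ lam, comp (r lam) lam = lam
  r_comp : ∀ lam mu, s lam = r mu → r (comp lam mu) = r lam
  s_comp : ∀ lam mu, s lam = r mu → s (comp lam mu) = s mu
  d_comp : ∀ lam mu, s lam = r mu → d (comp lam mu) = d lam + d mu
  comp_assoc : ∀ lam mu nu, s lam = r mu → s mu = r nu →
    comp (comp lam mu) nu = comp lam (comp mu nu)
  factor : ∀ lam m n, d lam = m + n →
    ∃! p : Path × Path, s p.1 = r p.2 ∧ d p.1 = m ∧ d p.2 = n ∧ comp p.1 p.2 = lam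

namespace KGraph

variable {k : ℕ} (Λ : KGraph k)

/-- Vertices are identified with the paths of degree `0`. -/
def IsVertex (v : Λ.Path) : Prop := Λ.d v = 0

/-- The unique factorisation of `lam` as a product of a path of degree `m` and the
remaining tail (junk value if `¬ m ≤ d lam`). -/
noncomputable def split (lam : Λ.Path) (m : Fin k → ℕ) : Λ.Path × Λ.Path :=
  if h : m ≤ Λ.d lam then
    (Λ.factor lam m (Λ.d lam - m) (by
      funext i
      exact (Nat.add_sub_cancel' (h i)).symm)).choose
  else (lam, lam)

/-- The segment `λ(m,n)` of the path `λ`: the unique path of degree `n - m` such that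
`λ = λ(0,m) λ(m,n) λ(n, d λ)` (meaningful for `m ≤ n ≤ d λ`). -/
noncomputable def seg (lam : Λ.Path) (m n : Fin k → ℕ) : Λ.Path :=
  (Λ.split (Λ.split lam n).1 m).2

/-- `MCE(μ,ν)`: minimal common extensions of `μ` and `ν`. -/
def MCE (mu nu : Λ.Path) : Set Λ.Path :=
  {lam | Λ.d lam = Λ.d mu ⊔ Λ.d nu ∧ Λ.seg lam 0 (Λ.d mu) = mu ∧ Λ.seg lam 0 (Λ.d nu) = nu}

/-- `Λ^min(μ,ν) = {(α,β) : μα = νβ ∈ MCE(μ,ν)}`. -/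
def Lmin (mu nu : Λ.Path) : Set (Λ.Path × Λ.Path) :=
  {p | Λ.s mu = Λ.r p.1 ∧ Λ.s nu = Λ.r p.2 ∧ Λ.comp mu p.1 = Λ.comp nu p.2 ∧
    Λ.comp mu p.1 ∈ Λ.MCE mu nu}

/-- `Ext(μ;E)`: extensions of `μ` with respect to `E`. -/
def Ext (mu : Λ.Path) (E : Set Λ.Path) : Set Λ.Path :=
  {a | Λ.r a = Λ.s mu ∧ ∃ nu ∈ E, ∃ b, (a, b) ∈ Λ.Lmin mu nu}

/-- `Λ` is finitely aligned if all the sets `MCE(μ,ν)` are finite. -/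
def FinitelyAligned : Prop := ∀ mu nu, (Λ.MCE mu nu).Finite

/-- `E ⊆ vΛ` is exhaustive if `Ext(λ;E) ≠ ∅` for all `λ ∈ vΛ`. -/
def Exhaustive (v : Λ.Path) (E : Set Λ.Path) : Prop :=
  ∀ lam, Λ.r lam = v → (Λ.Ext lam E).Nonempty

/-- `E ∈ vFE(Λ)`: `E ⊆ vΛ \ {v}` is finite and exhaustive (so `r(E) = v`). -/
def FEat (v : Λ.Path) (E : Set Λ.Path) : Prop :=
  Λ.IsVertex v ∧ (∀ lam ∈ E, Λ.r lam = v ∧ lam ≠ v) ∧ E.Finite ∧ Λ.Exhaustive v E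

/-- `FE(Λ)`: the finite exhaustive sets. -/
def FE : Set (Set Λ.Path) := {E | ∃ v, Λ.FEat v E}

/-- `λE = {λμ : μ ∈ E, r(μ) = s(λ)}`. -/
def lamSet (lam : Λ.Path) (E : Set Λ.Path) : Set Λ.Path :=
  {x | ∃ mu ∈ E, Λ.s lam = Λ.r mu ∧ Λ.comp lam mu = x}

/-- `EΛ = {λμ : λ ∈ E, r(μ) = s(λ)}`. -/
def setLam (E : Set Λ.Path) : Set Λ.Path :=
  {x | ∃ lam ∈ E, ∃ mu, Λ.s lam = Λ.r mu ∧ Λ.comp lam mu = x}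

/-- `𝓔 ⊆ FE(Λ)` is satiated if it satisfies (S1)--(S4). -/
def Satiated (𝓔 : Set (Set Λ.Path)) : Prop :=
  𝓔 ⊆ Λ.FE ∧
  (∀ G ∈ 𝓔, ∀ E ∈ Λ.FE, G ⊆ E → E ∈ 𝓔) ∧
  (∀ G ∈ 𝓔, ∀ v, Λ.FEat v G → ∀ mu, Λ.r mu = v → mu ∉ Λ.setLam G → Λ.Ext mu G ∈ 𝓔) ∧
  (∀ G ∈ 𝓔, ∀ n : Λ.Path → Fin k → ℕ, (∀ lam ∈ G, 0 < n lam ∧ n lam ≤ Λ.d lam) →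
    ((fun lam => Λ.seg lam 0 (n lam)) '' G) ∈ 𝓔) ∧
  (∀ G ∈ 𝓔, ∀ G' ⊆ G, ∀ Gl : Λ.Path → Set Λ.Path,
    (∀ lam ∈ G', Gl lam ∈ 𝓔 ∧ Λ.FEat (Λ.s lam) (Gl lam)) →
    ((G \ G') ∪ ⋃ lam ∈ G', Λ.lamSet lam (Gl lam)) ∈ 𝓔)

/-- The satiation `𝓔̄` of `𝓔`: the smallest satiated subset of `FE(Λ)` containing `𝓔`. -/
def satiation (𝓔 : Set (Set Λ.Path)) : Set (Set Λ.Path) :=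
  ⋂₀ {F | 𝓔 ⊆ F ∧ Λ.Satiated F}

/-- `ΠE`: the smallest subset of `Λ` containing `E` which is closed under the operation
`(λ,μ,σ) ↦ λ Ext(μ;{σ})` for `λ,μ,σ ∈ ΠE` with `d(λ) = d(μ)`, `s(λ) = s(μ)`. -/
def PiSet (E : Set Λ.Path) : Set Λ.Path :=
  ⋂₀ {G | E ⊆ G ∧ ∀ lam mu sig, lam ∈ G → mu ∈ G → sig ∈ G →
    Λ.d lam = Λ.d mu → Λ.s lam = Λ.s mu → Λ.lamSet lam (Λ.Ext mu {sig}) ⊆ G}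

/-- `Σ₁(𝓔)`: finite sets `F ⊆ r(E)Λ \ Λ⁰` containing some `E ∈ 𝓔`. -/
def Sig1 (𝓔 : Set (Set Λ.Path)) : Set (Set Λ.Path) :=
  {F | ∃ E ∈ 𝓔, ∃ v, Λ.FEat v E ∧ E ⊆ F ∧ F.Finite ∧
    ∀ lam ∈ F, Λ.r lam = v ∧ ¬ Λ.IsVertex lam}

/-- `Σ₂(𝓔) = {Ext(μ;E) : E ∈ 𝓔, μ ∈ r(E)Λ \ EΛ}`. -/
def Sig2 (𝓔 : Set (Set Λ.Path)) : Set (Set Λ.Path) :=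
  {F | ∃ E ∈ 𝓔, ∃ v, Λ.FEat v E ∧ ∃ mu, Λ.r mu = v ∧ mu ∉ Λ.setLam E ∧ F = Λ.Ext mu E}

/-- `Σ₃(𝓔) = {{λ(0,n_λ) : λ ∈ E} : E ∈ 𝓔, 0 < n_λ ≤ d(λ)}`. -/
def Sig3 (𝓔 : Set (Set Λ.Path)) : Set (Set Λ.Path) :=
  {F | ∃ E ∈ 𝓔, ∃ n : Λ.Path → Fin k → ℕ, (∀ lam ∈ E, 0 < n lam ∧ n lam ≤ Λ.d lam) ∧
    F = (fun lam => Λ.seg lam 0 (n lam)) '' E}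

/-- `Σ₄(𝓔) = {(E \ F) ∪ ⋃_{λ ∈ F} λ F_λ : E ∈ 𝓔, F ⊆ E, F_λ ∈ s(λ)𝓔}`. -/
def Sig4 (𝓔 : Set (Set Λ.Path)) : Set (Set Λ.Path) :=
  {G | ∃ E ∈ 𝓔, ∃ F ⊆ E, ∃ Fl : Λ.Path → Set Λ.Path,
    (∀ lam ∈ F, Fl lam ∈ 𝓔 ∧ Λ.FEat (Λ.s lam) (Fl lam)) ∧
    G = (E \ F) ∪ ⋃ lam ∈ F, Λ.lamSet lam (Fl lam)}

/-- `Σ = Σ₄ ∘ Σ₃ ∘ Σ₂ ∘ Σ₁`. -/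
def SigmaStep (𝓔 : Set (Set Λ.Path)) : Set (Set Λ.Path) :=
  Λ.Sig4 (Λ.Sig3 (Λ.Sig2 (Λ.Sig1 𝓔)))

/-- `Σ^∞(𝓔) = ⋃_{n ≥ 1} Σ^n(𝓔)`. -/
def SigmaInf (𝓔 : Set (Set Λ.Path)) : Set (Set Λ.Path) :=
  ⋃ n : ℕ, (Λ.SigmaStep)^[n + 1] 𝓔

section StarAlgebra

variable {A : Type*} [Ring A] [StarRing A]

/-- The product `∏_{λ ∈ E} (t_v - t_λ t_λ*)` (the factors pairwise commute for any
family satisfying (TCK1)--(TCK3), so the implicit choice of ordering is immaterial). -/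
noncomputable def gapProd (t : Λ.Path → A) (v : Λ.Path) (E : Set Λ.Path) : A :=
  listProd E fun lam => t v - t lam * star (t lam)

/-- Conditions (TCK1)--(TCK3) on a family `{t_λ}`. -/
def TCKFamily (t : Λ.Path → A) : Prop :=
  (∀ v, Λ.IsVertex v → star (t v) = t v ∧ t v * t v = t v) ∧
  (∀ v w, Λ.IsVertex v → Λ.IsVertex w → v ≠ w → t v * t w = 0) ∧
  (∀ lam mu, Λ.s lam = Λ.r mu → t lam * t mu = t (Λ.comp lam mu)) ∧
  (∀ lam mu, star (t lam) * t mu = ∑ᶠ p ∈ Λ.Lmin lam mu, t p.1 * star (t p.2))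

/-- A relative Cuntz-Krieger `(Λ;𝓔)`-family: (TCK1)--(TCK3) together with (CK). -/
def RCKFamily (𝓔 : Set (Set Λ.Path)) (t : Λ.Path → A) : Prop :=
  Λ.TCKFamily t ∧ ∀ E ∈ 𝓔, ∀ v, Λ.FEat v E → Λ.gapProd t v E = 0

/-- `Θ(t)^{ΠE}_{λ,μ} = t_λ (∏_{λν ∈ ΠE, d(ν) > 0} (t_{s(λ)} - t_ν t_ν*)) t_μ*`. -/
noncomputable def Theta (t : Λ.Path → A) (E : Set Λ.Path) (lam mu : Λ.Path) : A :=
  t lam *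
    listProd {nu | Λ.s lam = Λ.r nu ∧ ¬ Λ.IsVertex nu ∧ Λ.comp lam nu ∈ Λ.PiSet E}
      (fun nu => t (Λ.s lam) - t nu * star (t nu)) *
    star (t mu)

end StarAlgebra

end KGraph

/-- A graph morphism `x : Ω_{k,m} → Λ`, encoded by its length `m = d(x) ∈ (ℕ∪{∞})^k`
and its values `x(p,q)` on the morphisms `(p,q)` of `Ω_{k,m}` (with the junk value
`x(0,0)` outside the meaningful domain, so graph morphisms are extensional). -/
structure GMor {k : ℕ} (Λ : KGraph k) where
  len : Fin k → ℕ∞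
  seg : (Fin k → ℕ) → (Fin k → ℕ) → Λ.Path
  d_seg : ∀ p q, p ≤ q → (∀ i, (q i : ℕ∞) ≤ len i) → Λ.d (seg p q) = q - p
  r_seg : ∀ p q, p ≤ q → (∀ i, (q i : ℕ∞) ≤ len i) → Λ.r (seg p q) = seg p p
  s_seg : ∀ p q, p ≤ q → (∀ i, (q i : ℕ∞) ≤ len i) → Λ.s (seg p q) = seg q q
  comp_seg : ∀ p q u, p ≤ q → q ≤ u → (∀ i, (u i : ℕ∞) ≤ len i) →
    Λ.comp (seg p q) (seg q u) = seg p u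
  seg_junk : ∀ p q, ¬ (p ≤ q ∧ ∀ i, (q i : ℕ∞) ≤ len i) → seg p q = seg 0 0

namespace GMor

variable {k : ℕ} {Λ : KGraph k}

/-- The range `r(x) = x(0)` of a graph morphism. -/
def range (x : GMor Λ) : Λ.Path := x.seg 0 0

/-- `y = x|_n^{d(x)}`, the restriction of `x` (defined for `n ≤ d(x)`):
`d(y) = d(x) - n` and `y(p,q) = x(n+p, n+q)`. -/
def IsRestriction (y x : GMor Λ) (n : Fin k → ℕ) : Prop :=
  (∀ i, y.len i = x.len i - (n i : ℕ∞)) ∧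
  ∀ p q, p ≤ q → (∀ i, (q i : ℕ∞) ≤ y.len i) → y.seg p q = x.seg (n + p) (n + q)

/-- `y = λx`, the extension of `x` by `λ ∈ Λ r(x)`: `d(y) = d(λ) + d(x)`,
`y(0, d(λ)) = λ` and `y(d(λ), d(λ)+n) = x(0,n)` for `n ≤ d(x)`. -/
def IsExtension (y : GMor Λ) (lam : Λ.Path) (x : GMor Λ) : Prop :=
  (∀ i, y.len i = (Λ.d lam i : ℕ∞) + x.len i) ∧
  y.seg 0 (Λ.d lam) = lam ∧
  ∀ n : Fin k → ℕ, (∀ i, (n i : ℕ∞) ≤ x.len i) →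
    y.seg (Λ.d lam) (Λ.d lam + n) = x.seg 0 n

/-- `x ∈ FΛ^∞`: `x` has an initial segment belonging to `F`. -/
def HasInit (x : GMor Λ) (F : Set Λ.Path) : Prop :=
  ∃ lam ∈ F, (∀ i, (Λ.d lam i : ℕ∞) ≤ x.len i) ∧ x.seg 0 (Λ.d lam) = lam

/-- `z` restricts to `x` on `Ω_{k, d(x)}`. -/
def Agrees (z x : GMor Λ) : Prop :=
  ∀ p q, p ≤ q → (∀ i, (q i : ℕ∞) ≤ x.len i) → z.seg p q = x.seg p q

/-- `z ∈ MCE(x,y)` for graph morphisms `x, y`. -/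
def IsMCE (z x y : GMor Λ) : Prop :=
  (∀ i, z.len i = max (x.len i) (y.len i)) ∧ z.Agrees x ∧ z.Agrees y

/-- `x` is aperiodic: for distinct `λ, μ ∈ Λ r(x)`, `MCE(λx, μx) = ∅`. -/
def Aperiodic (x : GMor Λ) : Prop :=
  ∀ lam mu : Λ.Path, lam ≠ mu → Λ.s lam = x.range → Λ.s mu = x.range →
    ∀ lx mx : GMor Λ, lx.IsExtension lam x → mx.IsExtension mu x →
      ∀ z : GMor Λ, ¬ z.IsMCE lx mx

end GMor

namespace KGraph

variable {k : ℕ} (Λ : KGraph k)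

/-- `x ∈ ∂(Λ;𝓔)`: an `𝓔`-compatible boundary path. -/
def IsBdry (𝓔 : Set (Set Λ.Path)) (x : GMor Λ) : Prop :=
  ∀ n : Fin k → ℕ, (∀ i, (n i : ℕ∞) ≤ x.len i) →
    ∀ E ∈ 𝓔, Λ.FEat (x.seg n n) E →
      ∃ lam ∈ E, (∀ i, ((n + Λ.d lam) i : ℕ∞) ≤ x.len i) ∧ x.seg n (n + Λ.d lam) = lam

/-- Condition (C): aperiodic `𝓔`-compatible boundary paths out of every vertex, and
avoiding any given `F ∈ vFE(Λ) \ 𝓔`. -/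
def CondC (𝓔 : Set (Set Λ.Path)) : Prop :=
  (∀ v, Λ.IsVertex v → ∃ x : GMor Λ, Λ.IsBdry 𝓔 x ∧ x.range = v ∧ x.Aperiodic) ∧
  (∀ v F, Λ.FEat v F → F ∉ 𝓔 →
    ∃ x : GMor Λ, Λ.IsBdry 𝓔 x ∧ x.range = v ∧ ¬ x.HasInit F ∧ x.Aperiodic)

end KGraph

namespace KGraph

variable {k : ℕ} (Λ : KGraph k)

theorem comp_inj {a b a' b' : Λ.Path} (h : Λ.s a = Λ.r b) (h' : Λ.s a' = Λ.r b')
    (hd : Λ.d a = Λ.d a') (hc : Λ.comp a b = Λ.comp a' b') : a = a' ∧ b = b' := by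
  have hdb : Λ.d b' = Λ.d b := by
    have := congrArg Λ.d hc
    rw [Λ.d_comp _ _ h, Λ.d_comp _ _ h', hd] at this
    exact (add_left_cancel this).symm
  have := (Λ.factor (Λ.comp a b) (Λ.d a) (Λ.d b) (Λ.d_comp _ _ h)).unique
    (y₁ := (a, b)) (y₂ := (a', b')) ⟨h, rfl, rfl, rfl⟩ ⟨h', hd.symm, hdb, hc.symm⟩
  exact Prod.mk.inj this

theorem exists_comp_eq (lam : Λ.Path) {m : Fin k → ℕ} (hm : m ≤ Λ.d lam) :
    ∃ a b, Λ.s a = Λ.r b ∧ Λ.d a = m ∧ Λ.comp a b = lam := by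
  obtain ⟨p, ⟨h, hd, -, hc⟩, -⟩ :=
    Λ.factor lam m (Λ.d lam - m) (add_tsub_cancel_of_le hm).symm
  exact ⟨p.1, p.2, h, hd, hc⟩

theorem split_comp {a b : Λ.Path} (h : Λ.s a = Λ.r b) :
    Λ.split (Λ.comp a b) (Λ.d a) = (a, b) := by
  have hle : Λ.d a ≤ Λ.d (Λ.comp a b) := by
    rw [Λ.d_comp _ _ h]
    exact le_self_add
  have hf := Λ.factor (Λ.comp a b) (Λ.d a) (Λ.d (Λ.comp a b) - Λ.d a)
    (add_tsub_cancel_of_le hle).symm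
  obtain ⟨h', hd, -, hc⟩ := hf.choose_spec.1
  obtain ⟨ha, hb⟩ := Λ.comp_inj h' h hd hc
  rw [split, dif_pos hle]
  exact Prod.ext ha hb

theorem seg_comp {a b : Λ.Path} (h : Λ.s a = Λ.r b) :
    Λ.seg (Λ.comp a b) 0 (Λ.d a) = a := by
  have := Λ.split_comp (Λ.s_r a)
  rw [Λ.range_comp, Λ.d_r] at this
  rw [seg, Λ.split_comp h, this]

theorem mem_Lmin {mu nu a b : Λ.Path} :
    (a, b) ∈ Λ.Lmin mu nu ↔ Λ.s mu = Λ.r a ∧ Λ.s nu = Λ.r b ∧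
      Λ.comp mu a = Λ.comp nu b ∧ Λ.d mu + Λ.d a = Λ.d mu ⊔ Λ.d nu := by
  constructor
  · rintro ⟨ha, hb, hc, hd, -⟩
    exact ⟨ha, hb, hc, (Λ.d_comp _ _ ha).symm.trans hd⟩
  · rintro ⟨ha, hb, hc, hd⟩
    exact ⟨ha, hb, hc, (Λ.d_comp _ _ ha).trans hd, Λ.seg_comp ha, hc ▸ Λ.seg_comp hb⟩

theorem Ext_Ext_subset (E : Set Λ.Path) {l1 l2 : Λ.Path} (h2 : Λ.s l1 = Λ.r l2) :
    Λ.Ext l2 (Λ.Ext l1 E) ⊆ Λ.Ext (Λ.comp l1 l2) E := by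
  rintro a ⟨ha, nu, ⟨hnu, e, he, b, hb⟩, c, hc⟩
  obtain ⟨-, heb, hcb, hdb⟩ := Λ.mem_Lmin.1 hb
  obtain ⟨-, hnc, hcc, hdc⟩ := Λ.mem_Lmin.1 hc
  have hbc : Λ.s b = Λ.r c := by
    rw [← hnc, ← Λ.s_comp _ _ heb, ← hcb, Λ.s_comp _ _ hnu.symm]
  refine ⟨by rw [ha, Λ.s_comp _ _ h2], e, he, Λ.comp b c, Λ.mem_Lmin.2
    ⟨by rw [ha, Λ.s_comp _ _ h2], by rw [heb, Λ.r_comp _ _ hbc], ?_, ?_⟩⟩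
  · rw [Λ.comp_assoc _ _ _ h2 ha.symm, hcc, ← Λ.comp_assoc _ _ _ hnu.symm hnc, hcb,
      Λ.comp_assoc _ _ _ heb hbc]
  · rw [Λ.d_comp _ _ h2]
    funext i
    have h₁ := congrFun hdb i
    have h₂ := congrFun hdc i
    simp only [Pi.add_apply, Pi.sup_apply] at h₁ h₂ ⊢
    omega

theorem Ext_comp_subset (E : Set Λ.Path) {l1 l2 : Λ.Path} (h2 : Λ.s l1 = Λ.r l2) :
    Λ.Ext (Λ.comp l1 l2) E ⊆ Λ.Ext l2 (Λ.Ext l1 E) := by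
  rintro a ⟨ha, e, he, b, hb⟩
  obtain ⟨-, heb, hc, hd⟩ := Λ.mem_Lmin.1 hb
  rw [Λ.s_comp _ _ h2] at ha
  rw [Λ.comp_assoc _ _ _ h2 ha.symm] at hc
  rw [Λ.d_comp _ _ h2] at hd
  have hr : Λ.s l1 = Λ.r (Λ.comp l2 a) := by rw [Λ.r_comp _ _ ha.symm, h2]
  have hm : Λ.d l1 ⊔ Λ.d e ≤ Λ.d (Λ.comp l1 (Λ.comp l2 a)) := by
    rw [Λ.d_comp _ _ hr, Λ.d_comp _ _ ha.symm, ← add_assoc, hd]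
    exact sup_le_sup_right le_self_add _
  obtain ⟨g, h, hgh, hdg, hg⟩ := Λ.exists_comp_eq _ hm
  obtain ⟨l1', α, hα, hd1, rfl⟩ := Λ.exists_comp_eq g (hdg ▸ le_sup_left)
  obtain ⟨e', β, hβ, hde, hβg⟩ := Λ.exists_comp_eq _ (hdg ▸ le_sup_right)
  have hαh : Λ.s α = Λ.r h := by rw [← hgh, Λ.s_comp _ _ hα]
  have hβh : Λ.s β = Λ.r h := by rw [← hgh, ← hβg, Λ.s_comp _ _ hβ]
  obtain ⟨rfl, hα2⟩ := Λ.comp_inj (b := Λ.comp α h) (by rw [hα, Λ.r_comp _ _ hαh]) hr hd1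
    (by rw [← Λ.comp_assoc _ _ _ hα hαh, hg])
  obtain ⟨rfl, -⟩ := Λ.comp_inj (b := Λ.comp β h) (by rw [hβ, Λ.r_comp _ _ hβh]) heb hde
    (by rw [← Λ.comp_assoc _ _ _ hβ hβh, hβg, hg, hc])
  rw [Λ.d_comp _ _ hα] at hdg
  refine ⟨ha, α, ⟨hα.symm, e', he, β, Λ.mem_Lmin.2 ⟨hα, hβ, hβg.symm, hdg⟩⟩, h,
    Λ.mem_Lmin.2 ⟨ha.symm, hαh, hα2.symm, ?_⟩⟩
  funext i
  have h₁ := congrFun hdg i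
  have h₂ := congrFun hd i
  simp only [Pi.add_apply, Pi.sup_apply] at h₁ h₂ ⊢
  omega

end KGraph

/-- Lemma 4.10, Farthing-Muhly-Yeend: for `E ⊆ vΛ`, `λ₁ ∈ vΛ` and
`λ₂ ∈ s(λ₁)Λ`, we have `Ext(λ₂; Ext(λ₁;E)) = Ext(λ₁λ₂; E)`. -/
theorem statement7 {k : ℕ} (Λ : KGraph k)
    (v : Λ.Path) (hv : Λ.IsVertex v)
    (E : Set Λ.Path) (hEsub : ∀ lam ∈ E, Λ.r lam = v)
    (l1 : Λ.Path) (h1 : Λ.r l1 = v)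
    (l2 : Λ.Path) (h2 : Λ.r l2 = Λ.s l1) :
    Λ.Ext l2 (Λ.Ext l1 E) = Λ.Ext (Λ.comp l1 l2) E := by
  exact (Λ.Ext_Ext_subset E h2.symm).antisymm (Λ.Ext_comp_subset E h2.symm)
end

section
/- Let Λ be a finitely aligned k-graph and let 𝓔 ⊆ FE(Λ). Then 𝓔 ⊆ Σ_i(𝓔) ⊆ FE(Λ) for each i ∈ {1,2,3,4}. Moreover, if {t_λ : λ ∈ Λ} is a relative Cuntz-Krieger (Λ;𝓔)-family and E ∈ Σ_i(𝓔) for some i ∈ {1,2,3,4}, then ∏_{λ∈E}(t_{r(E)} − t_λt_λ*) = 0. -/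
open scoped ENNReal

attribute [local instance] Classical.propDecidable

section ListProd

variable {ι A : Type*} [Monoid A]

theorem mul_listProd_of_forall (S : Set ι) (f : ι → A) (x : A) (h : ∀ i ∈ S, x * f i = x) :
    x * listProd S f = x := by
  unfold listProd
  split_ifs with hS
  · have key : ∀ l : List ι, (∀ i ∈ l, i ∈ S) → x * (l.map f).prod = x := by
      intro l
      induction l with
      | nil => simp
      | cons a l ih =>
        intro hl
        rw [List.map_cons, List.prod_cons, ← mul_assoc, h a (hl a (by simp))]
        exact ih fun i hi => hl i (by simp [hi])
    exact key _ fun i hi => by simpa using hi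
  · simp

theorem listProd_mul_of_mem {S : Set ι} (hS : S.Finite) (f : ι → A)
    (hc : ∀ i ∈ S, ∀ j ∈ S, f i * f j = f j * f i) (hi : ∀ i ∈ S, f i * f i = f i)
    {i : ι} (hiS : i ∈ S) : listProd S f * f i = listProd S f := by
  unfold listProd
  rw [dif_pos hS]
  have key : ∀ l : List ι, (∀ j ∈ l, j ∈ S) → i ∈ l →
      (l.map f).prod * f i = (l.map f).prod := by
    intro l
    induction l with
    | nil => simp
    | cons a l ih =>
      intro hl hil
      have hl' : ∀ j ∈ l, j ∈ S := fun j hj => hl j (by simp [hj])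
      rw [List.map_cons, List.prod_cons, mul_assoc]
      by_cases hmem : i ∈ l
      · rw [ih hl' hmem]
      · obtain rfl : i = a := by simpa [hmem] using hil
        have hcomm : Commute (f i) (l.map f).prod := by
          refine Commute.list_prod_right _ _ fun y hy => ?_
          obtain ⟨j, hj, rfl⟩ := List.mem_map.1 hy
          exact hc i hiS j (hl' j hj)
        rw [← hcomm.eq, ← mul_assoc, hi i hiS]
  exact key _ (fun j hj => by simpa using hj) (by simpa using hiS)

end ListProd

namespace KGraph

variable {k : ℕ} {Λ : KGraph k}

section Paths

theorem comp_inj_s10 {μ ν α β : Λ.Path} (hμ : Λ.s μ = Λ.r α) (hν : Λ.s ν = Λ.r β)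
    (h : Λ.comp μ α = Λ.comp ν β) (hd : Λ.d μ = Λ.d ν) : μ = ν ∧ α = β := by
  have hdα : Λ.d β = Λ.d α := by
    have h1 := Λ.d_comp μ α hμ
    rw [h, Λ.d_comp ν β hν, hd] at h1
    exact add_left_cancel h1
  have := (Λ.factor (Λ.comp μ α) (Λ.d μ) (Λ.d α) (Λ.d_comp μ α hμ)).unique
    (y₁ := (μ, α)) (y₂ := (ν, β)) ⟨hμ, rfl, rfl, rfl⟩ ⟨hν, hd.symm, hdα, h.symm⟩
  simpa using this

theorem IsVertex.r_eq {v : Λ.Path} (hv : Λ.IsVertex v) : Λ.r v = v :=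
  (comp_inj_s10 (μ := Λ.r v) (α := v) (ν := v) (β := Λ.s v) (Λ.s_r v) (Λ.r_s v).symm
    ((Λ.range_comp v).trans (Λ.comp_source v).symm) ((Λ.d_r v).trans hv.symm)).1

theorem IsVertex.s_eq {v : Λ.Path} (hv : Λ.IsVertex v) : Λ.s v = v := by
  rw [← hv.r_eq, Λ.s_r]

theorem split_spec {L : Λ.Path} {m : Fin k → ℕ} (h : m ≤ Λ.d L) :
    Λ.s (Λ.split L m).1 = Λ.r (Λ.split L m).2 ∧ Λ.d (Λ.split L m).1 = m ∧
      Λ.d (Λ.split L m).2 = Λ.d L - m ∧ Λ.comp (Λ.split L m).1 (Λ.split L m).2 = L := by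
  unfold split
  rw [dif_pos h]
  exact (Λ.factor L m (Λ.d L - m) (add_tsub_cancel_of_le h).symm).choose_spec.1

theorem seg_zero (L : Λ.Path) (m : Fin k → ℕ) :
    Λ.seg L 0 m = (Λ.split L m).1 := by
  unfold seg
  generalize (Λ.split L m).1 = M
  obtain ⟨h1, h2, -, h4⟩ := split_spec (L := M) (m := 0) (fun i => Nat.zero_le _)
  have h5 := IsVertex.s_eq (Λ := Λ) h2
  rw [h5] at h1
  rw [h1, Λ.range_comp] at h4
  exact h4

theorem seg_zero_comp {μ α : Λ.Path} (h : Λ.s μ = Λ.r α) :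
    Λ.seg (Λ.comp μ α) 0 (Λ.d μ) = μ := by
  have hle : Λ.d μ ≤ Λ.d (Λ.comp μ α) := by
    rw [Λ.d_comp μ α h]
    exact le_self_add
  obtain ⟨h1, h2, -, h4⟩ := split_spec hle
  rw [seg_zero]
  exact (comp_inj_s10 h1 h h4 h2).1

theorem exists_comp_seg_zero {L : Λ.Path} {m : Fin k → ℕ} (h : m ≤ Λ.d L) :
    Λ.d (Λ.seg L 0 m) = m ∧
      ∃ α, Λ.s (Λ.seg L 0 m) = Λ.r α ∧ Λ.comp (Λ.seg L 0 m) α = L := by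
  obtain ⟨h1, h2, -, h4⟩ := split_spec h
  rw [seg_zero]
  exact ⟨h2, _, h1, h4⟩

/-- A common extension of `μ` and `ν` factors through a minimal one. -/
theorem exists_mem_Lmin {μ ν α β : Λ.Path} (hμ : Λ.s μ = Λ.r α) (hν : Λ.s ν = Λ.r β)
    (h : Λ.comp μ α = Λ.comp ν β) :
    ∃ p ∈ Λ.Lmin μ ν, ∃ c, Λ.s p.1 = Λ.r c ∧ Λ.s p.2 = Λ.r c ∧
      α = Λ.comp p.1 c ∧ β = Λ.comp p.2 c := by
  have hN : Λ.d μ ⊔ Λ.d ν ≤ Λ.d (Λ.comp μ α) := by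
    refine sup_le ?_ ?_
    · rw [Λ.d_comp μ α hμ]
      exact le_self_add
    · rw [h, Λ.d_comp ν β hν]
      exact le_self_add
  obtain ⟨hd, c, hc, hL⟩ := exists_comp_seg_zero hN
  set M := Λ.seg (Λ.comp μ α) 0 (Λ.d μ ⊔ Λ.d ν)
  have tail : ∀ σ γ, Λ.s σ = Λ.r γ → Λ.comp σ γ = Λ.comp μ α → Λ.d σ ≤ Λ.d M →
      ∃ a, Λ.s σ = Λ.r a ∧ Λ.comp σ a = M ∧ Λ.s a = Λ.r c ∧ γ = Λ.comp a c := by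
    intro σ γ hσ hσγ hle
    obtain ⟨hdσ, a, ha, haM⟩ := exists_comp_seg_zero hle
    set σ' := Λ.seg M 0 (Λ.d σ)
    have hac : Λ.s a = Λ.r c := by rw [← hc, ← haM, Λ.s_comp _ _ ha]
    have hr : Λ.s σ' = Λ.r (Λ.comp a c) := by rw [Λ.r_comp _ _ hac, ha]
    obtain ⟨e1, e2⟩ := comp_inj_s10 hr hσ
      (by rw [← Λ.comp_assoc _ _ _ ha hac, haM, hL, hσγ]) hdσ
    rw [e1] at ha haM
    exact ⟨a, ha, haM, hac, e2.symm⟩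
  obtain ⟨a, ha, haM, hac, hαa⟩ := tail μ α hμ rfl (by rw [hd]; exact le_sup_left)
  obtain ⟨b, hb, hbM, hbc, hβb⟩ := tail ν β hν h.symm (by rw [hd]; exact le_sup_right)
  refine ⟨(a, b), ⟨ha, hb, haM.trans hbM.symm, ?_⟩, c, hac, hbc, hαa, hβb⟩
  refine ⟨by rw [haM, hd], seg_zero_comp ha, ?_⟩
  change Λ.seg (Λ.comp μ a) 0 (Λ.d ν) = ν
  rw [haM, ← hbM]
  exact seg_zero_comp hb

theorem Lmin_finite (hΛ : Λ.FinitelyAligned) (μ ν : Λ.Path) : (Λ.Lmin μ ν).Finite := by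
  refine Set.Finite.of_finite_image (f := fun p => Λ.comp μ p.1)
    ((hΛ μ ν).subset ?_) ?_
  · rintro _ ⟨p, hp, rfl⟩
    exact hp.2.2.2
  · rintro p hp q hq (hpq : Λ.comp μ p.1 = Λ.comp μ q.1)
    refine Prod.ext (comp_inj_s10 hp.1 hq.1 hpq rfl).2 (comp_inj_s10 hp.2.1 hq.2.1 ?_ rfl).2
    rw [← hp.2.2.1, hpq, hq.2.2.1]

theorem Ext_finite (hΛ : Λ.FinitelyAligned) (μ : Λ.Path) {E : Set Λ.Path} (hE : E.Finite) :
    (Λ.Ext μ E).Finite := by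
  refine (hE.biUnion fun ν _ => (Lmin_finite hΛ μ ν).image Prod.fst).subset ?_
  rintro a ⟨-, ν, hν, b, hb⟩
  exact Set.mem_biUnion hν ⟨(a, b), hb, rfl⟩

theorem Ext_nonempty_iff {μ : Λ.Path} {E : Set Λ.Path} :
    (Λ.Ext μ E).Nonempty ↔ ∃ ν ∈ E, ∃ α β, Λ.s μ = Λ.r α ∧ Λ.s ν = Λ.r β ∧
      Λ.comp μ α = Λ.comp ν β := by
  constructor
  · rintro ⟨a, -, ν, hν, b, hb⟩
    exact ⟨ν, hν, a, b, hb.1, hb.2.1, hb.2.2.1⟩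
  · rintro ⟨ν, hν, α, β, h1, h2, h3⟩
    obtain ⟨p, hp, -⟩ := exists_mem_Lmin h1 h2 h3
    exact ⟨p.1, hp.1.symm, ν, hν, p.2, hp⟩

theorem FEat.nonempty {v : Λ.Path} {E : Set Λ.Path} (h : Λ.FEat v E) : E.Nonempty := by
  obtain ⟨-, -, ν, hν, -⟩ := h.2.2.2 v h.1.r_eq
  exact ⟨ν, hν⟩

theorem FEat.not_isVertex {v : Λ.Path} {E : Set Λ.Path} (h : Λ.FEat v E) {μ : Λ.Path}
    (hμ : μ ∈ E) : ¬ Λ.IsVertex μ := fun hv =>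
  (h.2.1 μ hμ).2 (hv.r_eq.symm.trans (h.2.1 μ hμ).1)

theorem FEat.unique {v w : Λ.Path} {E : Set Λ.Path} (h : Λ.FEat v E) (h' : Λ.FEat w E) :
    v = w := by
  obtain ⟨μ, hμ⟩ := h.nonempty
  rw [← (h.2.1 μ hμ).1, (h'.2.1 μ hμ).1]

theorem FEat.d_pos {v : Λ.Path} {E : Set Λ.Path} (h : Λ.FEat v E) {μ : Λ.Path}
    (hμ : μ ∈ E) : 0 < Λ.d μ :=
  lt_of_le_of_ne (fun _ => Nat.zero_le _) fun h0 => h.not_isVertex hμ h0.symm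

theorem FEat.mono {v : Λ.Path} {E F : Set Λ.Path} (h : Λ.FEat v E) (hEF : E ⊆ F)
    (hF : F.Finite) (hr : ∀ μ ∈ F, Λ.r μ = v ∧ ¬ Λ.IsVertex μ) : Λ.FEat v F := by
  refine ⟨h.1, fun μ hμ => ⟨(hr μ hμ).1, ?_⟩, hF, fun μ hμ => ?_⟩
  · rintro rfl
    exact (hr _ hμ).2 h.1
  · obtain ⟨a, ha, ν, hν, b, hb⟩ := h.2.2.2 μ hμ
    exact ⟨a, ha, ν, hEF hν, b, hb⟩

theorem Ext_vertex {v : Λ.Path} {E : Set Λ.Path} (hv : Λ.IsVertex v)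
    (hE : ∀ μ ∈ E, Λ.r μ = v) : Λ.Ext v E = E := by
  have hsv := hv.s_eq
  have vcomp : ∀ α, Λ.r α = v → Λ.comp v α = α := fun α hα => by
    rw [← hα, Λ.range_comp]
  ext a
  constructor
  · rintro ⟨ha, ν, hν, b, h1, h2, h3, h4⟩
    change Λ.s v = Λ.r a at h1
    change Λ.s ν = Λ.r b at h2
    change Λ.comp v a = Λ.comp ν b at h3
    have hda := h4.1
    change Λ.d (Λ.comp v a) = _ at hda
    have hbot : Λ.d v ⊔ Λ.d ν = Λ.d ν := by
      rw [show Λ.d v = 0 from hv]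
      exact sup_eq_right.2 fun _ => Nat.zero_le _
    rw [h3, hbot, Λ.d_comp _ _ h2] at hda
    have hb : Λ.IsVertex b := left_eq_add.1 hda.symm
    rw [vcomp a (by rw [← h1, hsv]), ← hb.r_eq, ← h2, Λ.comp_source] at h3
    rwa [h3]
  · intro ha
    have hra := hE a ha
    obtain ⟨⟨p, q⟩, hp, c, hc1, hc2, hac, hsc⟩ := exists_mem_Lmin (Λ := Λ) (μ := v) (ν := a)
      (α := a) (β := Λ.s a) (by rw [hsv, hra]) (Λ.r_s a).symm
      (by rw [vcomp a hra, Λ.comp_source])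
    have hdc := Λ.d_comp _ _ hc2
    rw [← hsc, Λ.d_s] at hdc
    have hc : Λ.IsVertex c := (add_eq_zero.1 hdc.symm).2
    rw [← hc.r_eq, ← hc1, Λ.comp_source] at hac
    obtain rfl : a = p := hac
    exact ⟨by rw [hsv, hra], a, ha, q, hp⟩

theorem FEat.ext (hΛ : Λ.FinitelyAligned) {v μ : Λ.Path} {E : Set Λ.Path} (h : Λ.FEat v E)
    (hμ : Λ.r μ = v) (hμE : μ ∉ Λ.setLam E) : Λ.FEat (Λ.s μ) (Λ.Ext μ E) := by
  refine ⟨Λ.d_s μ, ?_, Ext_finite hΛ μ h.2.2.1, ?_⟩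
  · rintro a ⟨ha, ν, hν, b, h1, h2, h3, -⟩
    refine ⟨ha, ?_⟩
    rintro rfl
    exact hμE ⟨ν, hν, b, h2, h3.symm.trans (Λ.comp_source μ)⟩
  · intro lam hlam
    obtain ⟨ν, hν, α, β, h1, h2, h3⟩ := Ext_nonempty_iff.1
      (h.2.2.2 (Λ.comp μ lam) (by rw [Λ.r_comp _ _ hlam.symm, hμ]))
    rw [Λ.s_comp _ _ hlam.symm] at h1
    rw [Λ.comp_assoc _ _ _ hlam.symm h1] at h3
    obtain ⟨p, hp, c, hc1, -, hpc, -⟩ :=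
      exists_mem_Lmin (by rw [Λ.r_comp _ _ h1, hlam]) h2 h3
    exact Ext_nonempty_iff.2 ⟨p.1, ⟨hp.1.symm, ν, hν, p.2, hp⟩, α, c, h1, hc1, hpc⟩

theorem FEat.image_seg {v : Λ.Path} {E : Set Λ.Path} (h : Λ.FEat v E)
    {n : Λ.Path → Fin k → ℕ} (hn : ∀ μ ∈ E, 0 < n μ ∧ n μ ≤ Λ.d μ) :
    Λ.FEat v ((fun μ => Λ.seg μ 0 (n μ)) '' E) := by
  refine ⟨h.1, ?_, h.2.2.1.image _, ?_⟩
  · rintro _ ⟨μ, hμ, rfl⟩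
    obtain ⟨hd, α, hα, hμα⟩ := exists_comp_seg_zero (hn μ hμ).2
    constructor
    · rw [← (h.2.1 μ hμ).1, ← Λ.r_comp _ _ hα, hμα]
    · intro he
      have hpos := (hn μ hμ).1
      rw [← hd] at hpos
      change 0 < Λ.d (Λ.seg μ 0 (n μ)) at hpos
      rw [show Λ.seg μ 0 (n μ) = v from he, show Λ.d v = 0 from h.1] at hpos
      exact lt_irrefl _ hpos
  · intro lam hlam
    obtain ⟨μ, hμ, α, β, h1, h2, h3⟩ := Ext_nonempty_iff.1 (h.2.2.2 lam hlam)
    obtain ⟨-, γ, hγ, hμγ⟩ := exists_comp_seg_zero (hn μ hμ).2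
    have hγβ : Λ.s γ = Λ.r β := by rw [← h2, ← hμγ, Λ.s_comp _ _ hγ]
    refine Ext_nonempty_iff.2 ⟨_, ⟨μ, hμ, rfl⟩, α, Λ.comp γ β, h1, ?_, ?_⟩
    · rw [Λ.r_comp _ _ hγβ]
      exact hγ
    · change _ = Λ.comp (Λ.seg μ 0 (n μ)) _
      rw [← Λ.comp_assoc _ _ _ hγ hγβ, hμγ, h3]

theorem FEat.replace {v : Λ.Path} {E F : Set Λ.Path} (h : Λ.FEat v E) (hF : F ⊆ E)
    {G : Λ.Path → Set Λ.Path} (hG : ∀ μ ∈ F, Λ.FEat (Λ.s μ) (G μ)) :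
    Λ.FEat v ((E \ F) ∪ ⋃ μ ∈ F, Λ.lamSet μ (G μ)) := by
  refine ⟨h.1, ?_, ?_, ?_⟩
  · rintro x (hx | hx)
    · exact h.2.1 x hx.1
    · obtain ⟨μ, hμ, ν, hν, hs, rfl⟩ := Set.mem_iUnion₂.1 hx
      refine ⟨by rw [Λ.r_comp _ _ hs, (h.2.1 μ (hF hμ)).1], fun he => ?_⟩
      have hd := Λ.d_comp _ _ hs
      rw [he, show Λ.d v = 0 from h.1] at hd
      exact h.not_isVertex (hF hμ) (add_eq_zero.1 hd.symm).1
  · refine (h.2.2.1.subset Set.sdiff_subset).union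
      ((h.2.2.1.subset hF).biUnion fun μ hμ => ?_)
    refine ((hG μ hμ).2.2.1.image (Λ.comp μ)).subset ?_
    rintro _ ⟨ν, hν, -, rfl⟩
    exact ⟨ν, hν, rfl⟩
  · intro lam hlam
    obtain ⟨μ, hμ, α, β, h1, h2, h3⟩ := Ext_nonempty_iff.1 (h.2.2.2 lam hlam)
    by_cases hμF : μ ∈ F
    · obtain ⟨ν, hν, γ, δ, h4, h5, h6⟩ :=
        Ext_nonempty_iff.1 ((hG μ hμF).2.2.2 β h2.symm)
      have hμν : Λ.s μ = Λ.r ν := ((hG μ hμF).2.1 ν hν).1.symm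
      have hαγ : Λ.s α = Λ.r γ := by
        rw [← Λ.s_comp _ _ h1, h3, Λ.s_comp _ _ h2, h4]
      refine Ext_nonempty_iff.2 ⟨Λ.comp μ ν,
        Or.inr (Set.mem_iUnion₂.2 ⟨μ, hμF, ν, hν, hμν, rfl⟩), Λ.comp α γ, δ, ?_, ?_, ?_⟩
      · rw [Λ.r_comp _ _ hαγ, h1]
      · rw [Λ.s_comp _ _ hμν, h5]
      · rw [← Λ.comp_assoc _ _ _ h1 hαγ, h3, Λ.comp_assoc _ _ _ h2 h4, h6,
          Λ.comp_assoc _ _ _ hμν h5]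
    · exact Ext_nonempty_iff.2 ⟨μ, Or.inl ⟨hμ, hμF⟩, α, β, h1, h2, h3⟩

end Paths

section Families

variable {A : Type*} [Ring A] [StarRing A] {t : Λ.Path → A}

theorem TCKFamily.r_mul (ht : Λ.TCKFamily t) (μ : Λ.Path) : t (Λ.r μ) * t μ = t μ := by
  rw [ht.2.2.1 _ _ (Λ.s_r μ), Λ.range_comp]

theorem TCKFamily.star_mul_r (ht : Λ.TCKFamily t) (μ : Λ.Path) :
    star (t μ) * t (Λ.r μ) = star (t μ) := by
  have h := congrArg star (ht.r_mul μ)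
  rwa [star_mul, (ht.1 _ (Λ.d_r μ)).1] at h

theorem TCKFamily.mul_s (ht : Λ.TCKFamily t) (μ : Λ.Path) : t μ * t (Λ.s μ) = t μ := by
  rw [ht.2.2.1 _ _ (Λ.r_s μ).symm, Λ.comp_source]

theorem Lmin_self (μ : Λ.Path) : Λ.Lmin μ μ = {(Λ.s μ, Λ.s μ)} := by
  ext ⟨a, b⟩
  simp only [Set.mem_singleton_iff, Prod.mk.injEq]
  constructor
  · rintro ⟨h1, h2, h3, h4, -⟩
    change Λ.s μ = Λ.r a at h1
    change Λ.s μ = Λ.r b at h2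
    change Λ.comp μ a = Λ.comp μ b at h3
    change Λ.d (Λ.comp μ a) = _ at h4
    rw [sup_idem, Λ.d_comp _ _ h1] at h4
    have ha : Λ.IsVertex a := left_eq_add.1 h4.symm
    have hab := (comp_inj_s10 h1 h2 h3 rfl).2
    rw [← hab, h1, ha.r_eq]
    exact ⟨rfl, rfl⟩
  · rintro ⟨rfl, rfl⟩
    have hc := seg_zero_comp (Λ.r_s μ).symm
    refine ⟨(Λ.r_s μ).symm, (Λ.r_s μ).symm, rfl, ?_, hc, hc⟩
    change Λ.d (Λ.comp μ (Λ.s μ)) = _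
    rw [Λ.comp_source, sup_idem]

theorem TCKFamily.star_mul_self (ht : Λ.TCKFamily t) (μ : Λ.Path) :
    star (t μ) * t μ = t (Λ.s μ) := by
  rw [ht.2.2.2, Lmin_self, finsum_mem_singleton]
  change t (Λ.s μ) * star (t (Λ.s μ)) = _
  rw [(ht.1 _ (Λ.d_s μ)).1, (ht.1 _ (Λ.d_s μ)).2]

theorem TCKFamily.mul_star_mul (ht : Λ.TCKFamily t) (μ : Λ.Path) :
    t μ * star (t μ) * t μ = t μ := by
  rw [mul_assoc, ht.star_mul_self, ht.mul_s]

theorem TCKFamily.star_mul_eq_sum (ht : Λ.TCKFamily t) (hΛ : Λ.FinitelyAligned)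
    (μ ν : Λ.Path) :
    star (t μ) * t ν = ∑ p ∈ (Lmin_finite hΛ μ ν).toFinset, t p.1 * star (t p.2) := by
  rw [ht.2.2.2, finsum_mem_eq_finite_toFinset_sum _ (Lmin_finite hΛ μ ν)]

theorem TCKFamily.proj_comm (ht : Λ.TCKFamily t) (hΛ : Λ.FinitelyAligned) (μ ν : Λ.Path) :
    t μ * star (t μ) * (t ν * star (t ν)) = t ν * star (t ν) * (t μ * star (t μ)) := by
  have hsum : t μ * star (t μ) * (t ν * star (t ν)) =
      ∑ p ∈ (Lmin_finite hΛ μ ν).toFinset,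
        t (Λ.comp μ p.1) * star (t (Λ.comp μ p.1)) := by
    calc t μ * star (t μ) * (t ν * star (t ν))
        = t μ * (star (t μ) * t ν) * star (t ν) := by simp only [mul_assoc]
      _ = _ := by
        rw [ht.star_mul_eq_sum hΛ, Finset.mul_sum, Finset.sum_mul]
        refine Finset.sum_congr rfl fun p hp => ?_
        obtain ⟨h1, h2, h3, -⟩ := (Set.Finite.mem_toFinset _).1 hp
        rw [← mul_assoc, mul_assoc, ← star_mul, ht.2.2.1 _ _ h1, ht.2.2.1 _ _ h2, h3]
  have hstar := congrArg star hsum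
  simp only [star_mul, star_star, star_sum] at hstar
  rw [hsum, ← hstar]

theorem TCKFamily.gap_comm (ht : Λ.TCKFamily t) (hΛ : Λ.FinitelyAligned) {v μ ν : Λ.Path}
    (hμ : Λ.r μ = v) (hν : Λ.r ν = v) :
    (t v - t μ * star (t μ)) * (t v - t ν * star (t ν)) =
      (t v - t ν * star (t ν)) * (t v - t μ * star (t μ)) := by
  have key : ∀ σ, Λ.r σ = v → t v * (t σ * star (t σ)) = t σ * star (t σ) ∧
      t σ * star (t σ) * t v = t σ * star (t σ) := by
    rintro σ rfl
    exact ⟨by rw [← mul_assoc, ht.r_mul], by rw [mul_assoc, ht.star_mul_r]⟩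
  simp only [mul_sub, sub_mul, key μ hμ, key ν hν, ht.proj_comm hΛ μ ν]
  abel

theorem TCKFamily.gap_mul (ht : Λ.TCKFamily t) {v μ : Λ.Path} (hμ : Λ.r μ = v) :
    (t v - t μ * star (t μ)) * t μ = 0 := by
  subst hμ
  rw [sub_mul, ht.r_mul, ht.mul_star_mul, sub_self]

theorem TCKFamily.gap_mul_vertex (ht : Λ.TCKFamily t) {v μ : Λ.Path} (hμ : Λ.r μ = v) :
    (t v - t μ * star (t μ)) * t v = t v - t μ * star (t μ) := by
  subst hμ
  rw [sub_mul, (ht.1 _ (Λ.d_r μ)).2, mul_assoc, ht.star_mul_r]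

theorem TCKFamily.gap_idem (ht : Λ.TCKFamily t) {v μ : Λ.Path} (hμ : Λ.r μ = v) :
    (t v - t μ * star (t μ)) * (t v - t μ * star (t μ)) = t v - t μ * star (t μ) := by
  rw [mul_sub, ht.gap_mul_vertex hμ, ← mul_assoc, ht.gap_mul hμ, zero_mul, sub_zero]

theorem TCKFamily.gapProd_mul_gap (ht : Λ.TCKFamily t) (hΛ : Λ.FinitelyAligned)
    {v : Λ.Path} {E : Set Λ.Path} (hE : Λ.FEat v E) {μ : Λ.Path} (hμ : μ ∈ E) :
    Λ.gapProd t v E * (t v - t μ * star (t μ)) = Λ.gapProd t v E :=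
  listProd_mul_of_mem hE.2.2.1 (fun μ => t v - t μ * star (t μ))
    (fun i hi j hj => ht.gap_comm hΛ (hE.2.1 i hi).1 (hE.2.1 j hj).1)
    (fun i hi => ht.gap_idem (hE.2.1 i hi).1) hμ

theorem TCKFamily.gapProd_mul (ht : Λ.TCKFamily t) (hΛ : Λ.FinitelyAligned)
    {v : Λ.Path} {E : Set Λ.Path} (hE : Λ.FEat v E) {μ : Λ.Path} (hμ : μ ∈ E) :
    Λ.gapProd t v E * t μ = 0 := by
  rw [← ht.gapProd_mul_gap hΛ hE hμ, mul_assoc, ht.gap_mul (hE.2.1 μ hμ).1, mul_zero]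

theorem TCKFamily.gapProd_mul_comp (ht : Λ.TCKFamily t) (hΛ : Λ.FinitelyAligned)
    {v : Λ.Path} {E : Set Λ.Path} (hE : Λ.FEat v E) {μ α : Λ.Path} (hμ : μ ∈ E)
    (hα : Λ.s μ = Λ.r α) : Λ.gapProd t v E * t (Λ.comp μ α) = 0 := by
  rw [← ht.2.2.1 _ _ hα, ← mul_assoc, ht.gapProd_mul hΛ hE hμ, zero_mul]

theorem TCKFamily.gapProd_mul_vertex (ht : Λ.TCKFamily t) (hΛ : Λ.FinitelyAligned)
    {v : Λ.Path} {E : Set Λ.Path} (hE : Λ.FEat v E) :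
    Λ.gapProd t v E * t v = Λ.gapProd t v E := by
  obtain ⟨μ, hμ⟩ := hE.nonempty
  conv_lhs => rw [← ht.gapProd_mul_gap hΛ hE hμ]
  rw [mul_assoc, ht.gap_mul_vertex (hE.2.1 μ hμ).1, ht.gapProd_mul_gap hΛ hE hμ]

/-- An element supported on `v` and annihilating every `t μ` with `μ ∈ E` vanishes as soon as
the gap product of `E` does. -/
theorem eq_zero_of_gapProd_eq_zero {v : Λ.Path} {E : Set Λ.Path}
    (hE : Λ.gapProd t v E = 0) {x : A} (hv : x * t v = x) (hx : ∀ μ ∈ E, x * t μ = 0) :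
    x = 0 := by
  have h : x * Λ.gapProd t v E = x := mul_listProd_of_forall _ _ _ fun μ hμ => by
    rw [mul_sub, hv, ← mul_assoc, hx μ hμ, zero_mul, sub_zero]
  rw [← h, hE, mul_zero]

variable {𝓔 : Set (Set Λ.Path)}

theorem RCKFamily.gapProd_mono (ht : Λ.RCKFamily 𝓔 t) (hΛ : Λ.FinitelyAligned)
    {v : Λ.Path} {E F : Set Λ.Path} (hE : E ∈ 𝓔) (hvE : Λ.FEat v E) (hvF : Λ.FEat v F)
    (hEF : E ⊆ F) : Λ.gapProd t v F = 0 :=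
  eq_zero_of_gapProd_eq_zero (ht.2 E hE v hvE) (ht.1.gapProd_mul_vertex hΛ hvF)
    fun _ hμ => ht.1.gapProd_mul hΛ hvF (hEF hμ)

theorem RCKFamily.gapProd_ext (ht : Λ.RCKFamily 𝓔 t) (hΛ : Λ.FinitelyAligned)
    {v μ : Λ.Path} {E : Set Λ.Path} (hE : E ∈ 𝓔) (hvE : Λ.FEat v E) (hμ : Λ.r μ = v)
    (hμE : μ ∉ Λ.setLam E) : Λ.gapProd t (Λ.s μ) (Λ.Ext μ E) = 0 := by
  have hX := hvE.ext hΛ hμ hμE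
  have hz : Λ.gapProd t (Λ.s μ) (Λ.Ext μ E) * star (t μ) = 0 := by
    refine eq_zero_of_gapProd_eq_zero (ht.2 E hE v hvE) ?_ fun ν hν => ?_
    · rw [mul_assoc, ← hμ, ht.1.star_mul_r]
    · rw [mul_assoc, ht.1.star_mul_eq_sum hΛ, Finset.mul_sum]
      refine Finset.sum_eq_zero fun p hp => ?_
      have hp' := (Set.Finite.mem_toFinset _).1 hp
      rw [← mul_assoc, ht.1.gapProd_mul hΛ hX ⟨hp'.1.symm, ν, hν, p.2, hp'⟩, zero_mul]
  rw [← ht.1.gapProd_mul_vertex hΛ hX, ← ht.1.star_mul_self, ← mul_assoc, hz, zero_mul]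

theorem RCKFamily.gapProd_image_seg (ht : Λ.RCKFamily 𝓔 t) (hΛ : Λ.FinitelyAligned)
    {v : Λ.Path} {E : Set Λ.Path} (hE : E ∈ 𝓔) (hvE : Λ.FEat v E)
    {n : Λ.Path → Fin k → ℕ} (hn : ∀ μ ∈ E, 0 < n μ ∧ n μ ≤ Λ.d μ) :
    Λ.gapProd t v ((fun μ => Λ.seg μ 0 (n μ)) '' E) = 0 := by
  have hX := hvE.image_seg hn
  refine eq_zero_of_gapProd_eq_zero (ht.2 E hE v hvE) (ht.1.gapProd_mul_vertex hΛ hX)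
    fun μ hμ => ?_
  obtain ⟨-, α, hα, hμα⟩ := exists_comp_seg_zero (hn μ hμ).2
  have h := ht.1.gapProd_mul_comp hΛ hX ⟨μ, hμ, rfl⟩ hα
  rwa [hμα] at h

theorem RCKFamily.gapProd_replace (ht : Λ.RCKFamily 𝓔 t) (hΛ : Λ.FinitelyAligned)
    {v : Λ.Path} {E F : Set Λ.Path} (hE : E ∈ 𝓔) (hvE : Λ.FEat v E) (hF : F ⊆ E)
    {G : Λ.Path → Set Λ.Path} (hG : ∀ μ ∈ F, G μ ∈ 𝓔 ∧ Λ.FEat (Λ.s μ) (G μ)) :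
    Λ.gapProd t v ((E \ F) ∪ ⋃ μ ∈ F, Λ.lamSet μ (G μ)) = 0 := by
  have hX := hvE.replace hF fun μ hμ => (hG μ hμ).2
  refine eq_zero_of_gapProd_eq_zero (ht.2 E hE v hvE) (ht.1.gapProd_mul_vertex hΛ hX)
    fun μ hμ => ?_
  by_cases hμF : μ ∈ F
  · obtain ⟨hGμ, hGs⟩ := hG μ hμF
    refine eq_zero_of_gapProd_eq_zero (ht.2 _ hGμ _ hGs) ?_ fun ν hν => ?_
    · rw [mul_assoc, ht.1.mul_s]
    · have hs : Λ.s μ = Λ.r ν := (hGs.2.1 ν hν).1.symm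
      rw [mul_assoc, ht.1.2.2.1 _ _ hs]
      exact ht.1.gapProd_mul hΛ hX (Or.inr (Set.mem_iUnion₂.2 ⟨μ, hμF, ν, hν, hs, rfl⟩))
  · exact ht.1.gapProd_mul hΛ hX (Or.inl ⟨hμ, hμF⟩)

end Families

end KGraph

/-- Lemma 5.3: `𝓔 ⊆ Σᵢ(𝓔) ⊆ FE(Λ)` for `i = 1,2,3,4`, and all gap
products over members of the `Σᵢ(𝓔)` vanish for any relative Cuntz-Krieger
`(Λ;𝓔)`-family. -/
theorem statement10 {k : ℕ} (Λ : KGraph k) (hΛ : Λ.FinitelyAligned)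
    (𝓔 : Set (Set Λ.Path)) (h𝓔 : 𝓔 ⊆ Λ.FE)
    {A : Type*} [NormedRing A] [StarRing A] [CStarRing A] [NormedAlgebra ℂ A]
    [CompleteSpace A] [StarModule ℂ A]
    (t : Λ.Path → A) (ht : Λ.RCKFamily 𝓔 t) :
    (𝓔 ⊆ Λ.Sig1 𝓔 ∧ Λ.Sig1 𝓔 ⊆ Λ.FE) ∧
      (𝓔 ⊆ Λ.Sig2 𝓔 ∧ Λ.Sig2 𝓔 ⊆ Λ.FE) ∧
      (𝓔 ⊆ Λ.Sig3 𝓔 ∧ Λ.Sig3 𝓔 ⊆ Λ.FE) ∧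
      (𝓔 ⊆ Λ.Sig4 𝓔 ∧ Λ.Sig4 𝓔 ⊆ Λ.FE) ∧
      ∀ E ∈ Λ.Sig1 𝓔 ∪ Λ.Sig2 𝓔 ∪ Λ.Sig3 𝓔 ∪ Λ.Sig4 𝓔,
        ∀ v, Λ.FEat v E → Λ.gapProd t v E = 0 := by
  refine ⟨⟨?_, ?_⟩, ⟨?_, ?_⟩, ⟨?_, ?_⟩, ⟨?_, ?_⟩, ?_⟩
  · intro E hE
    obtain ⟨v, hv⟩ := h𝓔 hE
    exact ⟨E, hE, v, hv, subset_rfl, hv.2.2.1,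
      fun μ hμ => ⟨(hv.2.1 μ hμ).1, hv.not_isVertex hμ⟩⟩
  · rintro F ⟨E, -, v, hv, hEF, hF, hr⟩
    exact ⟨v, hv.mono hEF hF hr⟩
  · intro E hE
    obtain ⟨v, hv⟩ := h𝓔 hE
    refine ⟨E, hE, v, hv, v, hv.1.r_eq, ?_,
      (KGraph.Ext_vertex hv.1 fun μ hμ => (hv.2.1 μ hμ).1).symm⟩
    rintro ⟨μ, hμ, α, hα, hμα⟩
    have hd := Λ.d_comp _ _ hα
    rw [hμα, show Λ.d v = 0 from hv.1] at hd
    exact hv.not_isVertex hμ (add_eq_zero.1 hd.symm).1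
  · rintro F ⟨E, -, v, hv, μ, hμ, hμE, rfl⟩
    exact ⟨Λ.s μ, hv.ext hΛ hμ hμE⟩
  · intro E hE
    obtain ⟨v, hv⟩ := h𝓔 hE
    refine ⟨E, hE, Λ.d, fun μ hμ => ⟨hv.d_pos hμ, le_rfl⟩, ?_⟩
    have hseg : ∀ μ, Λ.seg μ 0 (Λ.d μ) = μ := fun μ => by
      have h := KGraph.seg_zero_comp (Λ.r_s μ).symm
      rwa [Λ.comp_source] at h
    simp [hseg]
  · rintro F ⟨E, hE, n, hn, rfl⟩
    obtain ⟨v, hv⟩ := h𝓔 hE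
    exact ⟨v, hv.image_seg hn⟩
  · intro E hE
    exact ⟨E, hE, ∅, Set.empty_subset _, fun _ => ∅, by simp, by simp⟩
  · rintro _ ⟨E, hE, F, hF, G, hG, rfl⟩
    obtain ⟨v, hv⟩ := h𝓔 hE
    exact ⟨v, hv.replace hF fun μ hμ => (hG μ hμ).2⟩
  · rintro X (((⟨E, hE, w, hw, hEF, hF, hr⟩ | ⟨E, hE, w, hw, μ, hμ, hμE, rfl⟩) |
      ⟨E, hE, n, hn, rfl⟩) | ⟨E, hE, F, hF, G, hG, rfl⟩) v hv
    · obtain rfl := hv.unique (hw.mono hEF hF hr)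
      exact ht.gapProd_mono hΛ hE hw hv hEF
    · obtain rfl := hv.unique (hw.ext hΛ hμ hμE)
      exact ht.gapProd_ext hΛ hE hw hμ hμE
    · obtain ⟨w, hw⟩ := h𝓔 hE
      obtain rfl := hv.unique (hw.image_seg hn)
      exact ht.gapProd_image_seg hΛ hE hw hn
    · obtain ⟨w, hw⟩ := h𝓔 hE
      obtain rfl := hv.unique (hw.replace hF fun μ hμ => (hG μ hμ).2)
      exact ht.gapProd_replace hΛ hE hw hF hG
end
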